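/- Let O ⊆ ℝ^d be a nonempty open set with closure Ō and nonempty boundary ∂O, let ρ_∂ denote the distance to ∂O, and let T > 0. On a probability space (Ω,F,P) let X¹, X² : [0,T]×Ω → Ō be measurable processes and τ₁, τ₂ : Ω → [0,∞] measurable times such that X^i_t(ω) ∈ ∂O whenever t ≥ τ_i(ω) (i = 1,2), and let P_∂ : ℝ^d → ∂O be a measurable map satisfying |P_∂x − x| = ρ_∂(x) for all x ∈ Ō. Then, with τ₁,₂ := τ₁∧τ₂, for every t ∈ [0,T]: W₁(L^O_{X¹_t}, L^O_{X²_t}) ≤ E[|X¹_{t∧τ₁,₂} − X²_{t∧τ₁,₂}|] + E[ρ_∂(X¹_t) 1_{{t∧τ₁ ≥ τ₂}}] + E[ρ_∂(X²_t) 1_{{t∧τ₂ ≥ τ₁}}] (the inequality being trivially true if the right-hand side is infinite). -/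

import Mathlib

open MeasureTheory Set
open scoped ENNReal

noncomputable section

/-- Euclidean space `ℝ^d`. -/
abbrev Euc (d : ℕ) := EuclideanSpace ℝ (Fin d)

/-- The `O`-distribution of a random variable `ξ` under `P`:
the law of `ξ` restricted to the open set `O`. -/
def OLaw {Ω : Type*} [MeasurableSpace Ω] {d : ℕ} (P : Measure Ω)
    (ξ : Ω → Euc d) (O : Set (Euc d)) : Measure (Euc d) :=
  (P.map ξ).restrict O

/-- The set `C_O(μ,ν)` of couplings: probability measures `π` on `Ō × Ō` whose
first (resp. second) marginal restricted to `O` is `μ` (resp. `ν`). -/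
def CouplingO {d : ℕ} (O : Set (Euc d)) (μ ν : Measure (Euc d)) :
    Set (Measure (Euc d × Euc d)) :=
  {π | IsProbabilityMeasure π ∧ π ((closure O ×ˢ closure O)ᶜ) = 0 ∧
    (π.map Prod.fst).restrict O = μ ∧ (π.map Prod.snd).restrict O = ν}

/-- The `L¹`-Wasserstein distance `W₁` between sub-probability measures on `O`,
valued in `[0,∞]` (so inequalities with an infinite right-hand side are trivially true). -/
def W1 {d : ℕ} (O : Set (Euc d)) (μ ν : Measure (Euc d)) : ℝ≥0∞ :=
  ⨅ π ∈ CouplingO O μ ν, ∫⁻ p, ENNReal.ofReal (dist p.1 p.2) ∂π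

/-- Two random variables that agree whenever one of them lies in `S` have the same law on `S`. -/
lemma restrict_map_congr {Ω E : Type*} [MeasurableSpace Ω] [MeasurableSpace E] {P : Measure Ω}
    {S : Set E} (hS : MeasurableSet S) {f g : Ω → E} (hf : Measurable f) (hg : Measurable g)
    (h : ∀ ω, f ω = g ω ∨ f ω ∉ S ∧ g ω ∉ S) :
    (P.map f).restrict S = (P.map g).restrict S := by
  ext A hA
  rw [Measure.restrict_apply hA, Measure.restrict_apply hA,
    Measure.map_apply hf (hA.inter hS), Measure.map_apply hg (hA.inter hS)]
  congr 1
  ext ω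
  rcases h ω with h | h
  · simp [h]
  · simp [h.1, h.2]

/-- the coupling-by-projection estimate for `W₁`: with
`τ₁,₂ := τ₁ ∧ τ₂` and `ρ_∂ = dist(·, ∂O)`, for every `t ∈ [0,T]`,
`W₁(L^O_{X¹_t}, L^O_{X²_t}) ≤ E[|X¹_{t∧τ₁,₂} − X²_{t∧τ₁,₂}|]
  + E[ρ_∂(X¹_t) 1_{t∧τ₁ ≥ τ₂}] + E[ρ_∂(X²_t) 1_{t∧τ₂ ≥ τ₁}]`. -/
theorem W1_le_coupling_by_projection {d : ℕ}
    (O : Set (Euc d)) (hO : IsOpen O) (hOne : O.Nonempty)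
    (hfr : (frontier O).Nonempty) (T : ℝ) (hT : 0 < T)
    {Ω : Type*} [MeasurableSpace Ω] (P : Measure Ω) [IsProbabilityMeasure P]
    (X1 X2 : ℝ → Ω → Euc d)
    (hX1m : Measurable fun p : ℝ × Ω => X1 p.1 p.2)
    (hX2m : Measurable fun p : ℝ × Ω => X2 p.1 p.2)
    (hX1c : ∀ t ∈ Icc (0:ℝ) T, ∀ ω, X1 t ω ∈ closure O)
    (hX2c : ∀ t ∈ Icc (0:ℝ) T, ∀ ω, X2 t ω ∈ closure O)
    (τ1 τ2 : Ω → ℝ≥0∞) (hτ1 : Measurable τ1) (hτ2 : Measurable τ2)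
    (hb1 : ∀ t ∈ Icc (0:ℝ) T, ∀ ω, τ1 ω ≤ ENNReal.ofReal t → X1 t ω ∈ frontier O)
    (hb2 : ∀ t ∈ Icc (0:ℝ) T, ∀ ω, τ2 ω ≤ ENNReal.ofReal t → X2 t ω ∈ frontier O)
    (Pb : Euc d → Euc d) (hPbm : Measurable Pb) (hPbr : ∀ x, Pb x ∈ frontier O)
    (hPbd : ∀ x ∈ closure O, dist (Pb x) x = Metric.infDist x (frontier O)) :
    ∀ t ∈ Icc (0:ℝ) T,
      W1 O (OLaw P (X1 t) O) (OLaw P (X2 t) O) ≤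
        (∫⁻ ω, ENNReal.ofReal (dist
            (X1 ((ENNReal.ofReal t ⊓ (τ1 ω ⊓ τ2 ω)).toReal) ω)
            (X2 ((ENNReal.ofReal t ⊓ (τ1 ω ⊓ τ2 ω)).toReal) ω)) ∂P)
        + (∫⁻ ω in {ω | τ2 ω ≤ ENNReal.ofReal t ⊓ τ1 ω},
            ENNReal.ofReal (Metric.infDist (X1 t ω) (frontier O)) ∂P)
        + (∫⁻ ω in {ω | τ1 ω ≤ ENNReal.ofReal t ⊓ τ2 ω},
            ENNReal.ofReal (Metric.infDist (X2 t ω) (frontier O)) ∂P) := by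
  intro t ht
  have hdisj : ∀ x ∈ frontier O, x ∉ O := fun x hx hxO =>
    hx.2 (hO.interior_eq.symm ▸ hxO)
  have hcl : ∀ x, Pb x ∈ closure O := fun x => frontier_subset_closure (hPbr x)
  have hX1 : Measurable (X1 t) := hX1m.comp measurable_prodMk_left
  have hX2 : Measurable (X2 t) := hX2m.comp measurable_prodMk_left
  have hA : MeasurableSet {ω | ENNReal.ofReal t ≤ τ1 ω ⊓ τ2 ω} :=
    measurableSet_le measurable_const (hτ1.inf hτ2)
  have hB : MeasurableSet {ω | τ2 ω < ENNReal.ofReal t ⊓ τ1 ω} :=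
    measurableSet_lt hτ2 (measurable_const.inf hτ1)
  have hC1 : MeasurableSet {ω | τ2 ω ≤ ENNReal.ofReal t ⊓ τ1 ω} :=
    measurableSet_le hτ2 (measurable_const.inf hτ1)
  have hC2 : MeasurableSet {ω | τ1 ω ≤ ENNReal.ofReal t ⊓ τ2 ω} :=
    measurableSet_le hτ1 (measurable_const.inf hτ2)
  classical
  let Y : Ω → Euc d × Euc d := fun ω =>
    if ENNReal.ofReal t ≤ τ1 ω ⊓ τ2 ω then (X1 t ω, X2 t ω)
    else if τ2 ω < ENNReal.ofReal t ⊓ τ1 ω then (X1 t ω, Pb (X1 t ω))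
    else (Pb (X2 t ω), X2 t ω)
  have hY : Measurable Y :=
    Measurable.ite hA (hX1.prodMk hX2)
      (Measurable.ite hB (hX1.prodMk (hPbm.comp hX1)) ((hPbm.comp hX2).prodMk hX2))
  have hthird : ∀ ω, ¬ ENNReal.ofReal t ≤ τ1 ω ⊓ τ2 ω → ¬ τ2 ω < ENNReal.ofReal t ⊓ τ1 ω →
      τ1 ω ≤ ENNReal.ofReal t ⊓ τ2 ω := by
    intro ω h1 h2
    rw [le_inf_iff]
    rw [le_inf_iff, not_and_or, not_le, not_le] at h1
    rw [lt_inf_iff, not_and_or, not_lt, not_lt] at h2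
    rcases h1 with h1 | h1
    · exact ⟨h1.le, h2.elim h1.le.trans id⟩
    · have h3 := h2.resolve_left h1.not_ge
      exact ⟨h3.trans h1.le, h3⟩
  have hYO : ∀ ω, Y ω ∈ closure O ×ˢ closure O := by
    intro ω
    dsimp only [Y]
    split_ifs
    exacts [⟨hX1c t ht ω, hX2c t ht ω⟩, ⟨hX1c t ht ω, hcl _⟩, ⟨hcl _, hX2c t ht ω⟩]
  have hfst : ∀ ω, (Y ω).1 = X1 t ω ∨ (Y ω).1 ∉ O ∧ X1 t ω ∉ O := by
    intro ω
    dsimp only [Y]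
    split_ifs with h1 h2
    · exact .inl rfl
    · exact .inl rfl
    · exact .inr ⟨hdisj _ (hPbr _),
        hdisj _ (hb1 t ht ω ((hthird ω h1 h2).trans inf_le_left))⟩
  have hsnd : ∀ ω, (Y ω).2 = X2 t ω ∨ (Y ω).2 ∉ O ∧ X2 t ω ∉ O := by
    intro ω
    dsimp only [Y]
    split_ifs with h1 h2
    · exact .inl rfl
    · exact .inr ⟨hdisj _ (hPbr _), hdisj _ (hb2 t ht ω (h2.le.trans inf_le_left))⟩
    · exact .inl rfl
  have hcoupling : P.map Y ∈ CouplingO O (OLaw P (X1 t) O) (OLaw P (X2 t) O) := by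
    refine ⟨Measure.isProbabilityMeasure_map hY.aemeasurable, ?_, ?_, ?_⟩
    · rw [Measure.map_apply hY
        (isClosed_closure.measurableSet.prod isClosed_closure.measurableSet).compl]
      convert measure_empty (μ := P)
      exact eq_empty_of_forall_notMem fun ω h => h (hYO ω)
    · rw [Measure.map_map measurable_fst hY]
      exact restrict_map_congr hO.measurableSet (measurable_fst.comp hY) hX1 hfst
    · rw [Measure.map_map measurable_snd hY]
      exact restrict_map_congr hO.measurableSet (measurable_snd.comp hY) hX2 hsnd
  have hρ : Measurable fun x : Euc d => ENNReal.ofReal (Metric.infDist x (frontier O)) :=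
    (Metric.continuous_infDist_pt _).measurable.ennreal_ofReal
  have hρ1 : Measurable fun ω => ENNReal.ofReal (Metric.infDist (X1 t ω) (frontier O)) :=
    hρ.comp hX1
  have hρ2 : Measurable fun ω => ENNReal.ofReal (Metric.infDist (X2 t ω) (frontier O)) :=
    hρ.comp hX2
  refine (iInf₂_le _ hcoupling).trans ?_
  rw [lintegral_map (measurable_fst.dist measurable_snd).ennreal_ofReal hY,
    ← lintegral_indicator hC1, ← lintegral_indicator hC2,
    ← lintegral_add_right _ (hρ1.indicator hC1),
    ← lintegral_add_right _ (hρ2.indicator hC2)]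
  refine lintegral_mono fun ω => ?_
  dsimp only [Y]
  split_ifs with h1 h2
  · rw [inf_eq_left.2 h1, ENNReal.toReal_ofReal ht.1, add_assoc]
    exact le_self_add
  · rw [indicator_of_mem (s := {ω | τ2 ω ≤ ENNReal.ofReal t ⊓ τ1 ω}) h2.le, dist_comm,
      hPbd _ (hX1c t ht ω)]
    exact le_add_self.trans le_self_add
  · rw [indicator_of_mem (s := {ω | τ1 ω ≤ ENNReal.ofReal t ⊓ τ2 ω}) (hthird ω h1 h2),
      hPbd _ (hX2c t ht ω)]
    exact le_add_self

end
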